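/- arXiv:1810.06775 — 5 statements merged into one kernel-verified Lean document; each statement's English description precedes it below -/
import Mathlib

section
/- Let E and F be finite-dimensional real inner product spaces and let T : E → F be a surjective linear map. Then the composition T ∘ T* : F → F (where T* is the adjoint of T) is invertible, and for every nonzero y ∈ F and every z ∈ F, setting x := T*(z) and η̂ := ‖y + T(x)‖ / ‖y‖, one has ‖x‖ ≤ (1 + η̂) · ‖T⁺‖ · ‖y‖, where T⁺ := T* ∘ (T ∘ T*)⁻¹ and ‖T⁺‖ denotes its operator norm. -/
/-- For a surjective linear map `T`, the composition `T ∘ T*` is injective. -/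
theorem LinearMap.injective_comp_adjoint_of_surjective {E F : Type*}
    [NormedAddCommGroup E] [InnerProductSpace ℝ E] [FiniteDimensional ℝ E]
    [NormedAddCommGroup F] [InnerProductSpace ℝ F] [FiniteDimensional ℝ F]
    (T : E →ₗ[ℝ] F) (hT : Function.Surjective T) :
    Function.Injective (T ∘ₗ LinearMap.adjoint T) := by
  rw [injective_iff_map_eq_zero]
  intro z hz
  have hx : LinearMap.adjoint T z = 0 := by
    rw [← inner_self_eq_zero (𝕜 := ℝ), LinearMap.adjoint_inner_left]
    rw [LinearMap.comp_apply] at hz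
    rw [hz, inner_zero_right]
  obtain ⟨u, rfl⟩ := hT z
  rw [← inner_self_eq_zero (𝕜 := ℝ), ← LinearMap.adjoint_inner_left, hx, inner_zero_left]

/-- Theorem 3.1(a): for a surjective linear map `T` between
finite-dimensional real inner product spaces, `T ∘ T*` is invertible (witnessed by a
two-sided inverse `S`), and with `x := T*(z)`, `η̂ := ‖y + T x‖ / ‖y‖`, and
`T⁺ := T* ∘ (T ∘ T*)⁻¹`, one has `‖x‖ ≤ (1 + η̂) ‖T⁺‖ ‖y‖`. -/
theorem stmt_0 {E F : Type*}
    [NormedAddCommGroup E] [InnerProductSpace ℝ E] [FiniteDimensional ℝ E]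
    [NormedAddCommGroup F] [InnerProductSpace ℝ F] [FiniteDimensional ℝ F]
    (T : E →ₗ[ℝ] F) (hT : Function.Surjective T) :
    ∃ S : F →ₗ[ℝ] F,
      (T ∘ₗ LinearMap.adjoint T) ∘ₗ S = LinearMap.id ∧
      S ∘ₗ (T ∘ₗ LinearMap.adjoint T) = LinearMap.id ∧
      ∀ y : F, y ≠ 0 → ∀ z : F,
        ‖LinearMap.adjoint T z‖ ≤
          (1 + ‖y + T (LinearMap.adjoint T z)‖ / ‖y‖) *
            ‖LinearMap.toContinuousLinearMap (LinearMap.adjoint T ∘ₗ S)‖ * ‖y‖ := by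
  let e := LinearEquiv.ofInjectiveEndo _ (T.injective_comp_adjoint_of_surjective hT)
  have he (z : F) : e z = T (LinearMap.adjoint T z) := rfl
  refine ⟨e.symm.toLinearMap, LinearMap.ext e.apply_symm_apply,
    LinearMap.ext e.symm_apply_apply, fun y hy z => ?_⟩
  have hy' : ‖y‖ ≠ 0 := norm_ne_zero_iff.mpr hy
  set P := LinearMap.toContinuousLinearMap (LinearMap.adjoint T ∘ₗ e.symm.toLinearMap)
  have hP : P (e z) = LinearMap.adjoint T z :=
    congrArg (LinearMap.adjoint T) (e.symm_apply_apply z)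
  have htri : ‖e z‖ ≤ ‖y + e z‖ + ‖y‖ := by
    simpa using norm_sub_le (y + e z) y
  rw [← he]
  calc ‖LinearMap.adjoint T z‖ = ‖P (e z)‖ := by rw [hP]
    _ ≤ ‖P‖ * ‖e z‖ := P.le_opNorm _
    _ ≤ ‖P‖ * (‖y + e z‖ + ‖y‖) := by gcongr
    _ = (1 + ‖y + e z‖ / ‖y‖) * ‖P‖ * ‖y‖ := by
      field_simp
      ring
end

section
/- Let E and F be finite-dimensional real inner product spaces, T : E → F a surjective linear map, y ∈ F nonzero, z ∈ F, x := T*(z), and η̂ := ‖y + T(x)‖ / ‖y‖. Suppose 0 ≤ η̂ ≤ η_max < 1. Then for every η with η̂ ≤ η ≤ 1, the backtracking point σ(η) := ((1 − η)/(1 − η̂)) · x satisfies ‖σ(η)‖ ≤ ((1 + η_max)/(1 − η_max)) · (1 − η) · ‖T⁺‖ · ‖y‖, where T⁺ := T* ∘ (T ∘ T*)⁻¹ and ‖T⁺‖ denotes its operator norm. -/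
/-- Theorem 3.1(b): bound on the backtracking curve
`σ(η) := ((1 − η)/(1 − η̂)) • x`, where `x := T*(z)`, `η̂ := ‖y + T x‖/‖y‖ ≤ η_max < 1`,
and `T⁺ := T* ∘ (T ∘ T*)⁻¹` (the inverse of `T ∘ T*` being witnessed by `S`). -/
theorem stmt_1 {E F : Type*}
    [NormedAddCommGroup E] [InnerProductSpace ℝ E] [FiniteDimensional ℝ E]
    [NormedAddCommGroup F] [InnerProductSpace ℝ F] [FiniteDimensional ℝ F]
    (T : E →ₗ[ℝ] F) (hT : Function.Surjective T)
    (S : F →ₗ[ℝ] F)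
    (hS1 : (T ∘ₗ LinearMap.adjoint T) ∘ₗ S = LinearMap.id)
    (hS2 : S ∘ₗ (T ∘ₗ LinearMap.adjoint T) = LinearMap.id)
    (y : F) (hy : y ≠ 0) (z : F) (etamax : ℝ)
    (hetah0 : 0 ≤ ‖y + T (LinearMap.adjoint T z)‖ / ‖y‖)
    (hetah : ‖y + T (LinearMap.adjoint T z)‖ / ‖y‖ ≤ etamax) (hetamax : etamax < 1)
    (eta : ℝ) (heta1 : ‖y + T (LinearMap.adjoint T z)‖ / ‖y‖ ≤ eta) (heta2 : eta ≤ 1) :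
    ‖((1 - eta) / (1 - ‖y + T (LinearMap.adjoint T z)‖ / ‖y‖)) • LinearMap.adjoint T z‖ ≤
      ((1 + etamax) / (1 - etamax)) * (1 - eta) *
        ‖LinearMap.toContinuousLinearMap (LinearMap.adjoint T ∘ₗ S)‖ * ‖y‖ := by
  have hx : (LinearMap.adjoint T ∘ₗ S) (T (LinearMap.adjoint T z)) = LinearMap.adjoint T z :=
    congrArg (LinearMap.adjoint T) (LinearMap.congr_fun hS2 z)
  have hxP : ‖LinearMap.adjoint T z‖ ≤
      ‖LinearMap.toContinuousLinearMap (LinearMap.adjoint T ∘ₗ S)‖ *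
        ‖T (LinearMap.adjoint T z)‖ := by
    have h := (LinearMap.toContinuousLinearMap (LinearMap.adjoint T ∘ₗ S)).le_opNorm
      (T (LinearMap.adjoint T z))
    rwa [LinearMap.coe_toContinuousLinearMap', hx] at h
  have hy0 : 0 < ‖y‖ := norm_pos_iff.mpr hy
  have hTx : ‖T (LinearMap.adjoint T z)‖ ≤
      (1 + ‖y + T (LinearMap.adjoint T z)‖ / ‖y‖) * ‖y‖ := by
    rw [add_mul, div_mul_cancel₀ _ hy0.ne', one_mul, add_comm]
    simpa using norm_sub_le (y + T (LinearMap.adjoint T z)) y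
  have hP := norm_nonneg (LinearMap.toContinuousLinearMap (LinearMap.adjoint T ∘ₗ S))
  generalize ‖y + T (LinearMap.adjoint T z)‖ / ‖y‖ = etah at *
  generalize ‖LinearMap.toContinuousLinearMap (LinearMap.adjoint T ∘ₗ S)‖ = P at *
  have h1 : 0 < 1 - etah := by linarith
  have h2 : 0 < 1 - etamax := by linarith
  have h3 : 0 ≤ 1 - eta := by linarith
  rw [norm_smul, Real.norm_of_nonneg (by positivity)]
  calc (1 - eta) / (1 - etah) * ‖LinearMap.adjoint T z‖
      ≤ (1 - eta) / (1 - etah) * (P * ((1 + etah) * ‖y‖)) := by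
        gcongr
        exact hxP.trans (by gcongr)
    _ = (1 + etah) / (1 - etah) * (1 - eta) * P * ‖y‖ := by ring
    _ ≤ (1 + etamax) / (1 - etamax) * (1 - eta) * P * ‖y‖ := by
        have : 0 ≤ 1 + etamax := by linarith
        gcongr
end

section
/- Let n ∈ ℕ and let U, V, Σ, ΔU, ΔV, ΔW, ΔZ, H be real n×n matrices. Suppose UᵀU = I, VᵀV = I, UᵀΔU and VᵀΔV are skew-symmetric, and H ⊙ ΔW = ΔW (Hadamard product). Then ⟨ΔZ, ΔU Σ Vᵀ + U Σ ΔVᵀ − ΔW⟩ = ⟨(1/2)(ΔZ V Σᵀ − U Σ Vᵀ ΔZᵀ U), ΔU⟩ + ⟨(1/2)(ΔZᵀ U Σ − V Σᵀ Uᵀ ΔZ V), ΔV⟩ + ⟨−H ⊙ ΔZ, ΔW⟩, where ⟨A, B⟩ := trace(A Bᵀ) is the Frobenius inner product. -/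
open Matrix

theorem mul_transpose_eq_neg_of_transpose_mul_skew {ι R : Type*} [Fintype ι] [DecidableEq ι]
    [CommRing R] {U D : Matrix ι ι R} (hU : Uᵀ * U = 1) (hD : (Uᵀ * D)ᵀ = -(Uᵀ * D)) :
    U * Dᵀ = -(D * Uᵀ) := by
  have hU' : U * Uᵀ = 1 := mul_eq_one_comm.mp hU
  rw [transpose_mul, transpose_transpose] at hD
  calc U * Dᵀ = U * (Dᵀ * U) * Uᵀ := by simp only [Matrix.mul_assoc, hU', Matrix.mul_one]
    _ = -(U * Uᵀ * D * Uᵀ) := by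
        rw [hD]
        simp only [Matrix.mul_neg, Matrix.neg_mul, Matrix.mul_assoc]
    _ = -(D * Uᵀ) := by rw [hU', Matrix.one_mul]

/-- Pairing a tangent vector `D` of the orthogonal group at `U` with `M` only sees the
tangential projection of `M`. -/
theorem trace_tangent_projection_mul_transpose {ι : Type*} [Fintype ι] [DecidableEq ι]
    {U D : Matrix ι ι ℝ} (M : Matrix ι ι ℝ) (hU : Uᵀ * U = 1)
    (hD : (Uᵀ * D)ᵀ = -(Uᵀ * D)) :
    trace (((1 / 2 : ℝ) • (M - U * Mᵀ * U)) * Dᵀ) = trace (M * Dᵀ) := by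
  have h : trace (U * Mᵀ * U * Dᵀ) = -trace (M * Dᵀ) := by
    calc trace (U * Mᵀ * U * Dᵀ) = -trace (U * (Mᵀ * D * Uᵀ)) := by
          rw [Matrix.mul_assoc, mul_transpose_eq_neg_of_transpose_mul_skew hU hD,
            Matrix.mul_neg, trace_neg]
          simp only [Matrix.mul_assoc]
      _ = -trace (Mᵀ * D) := by
          rw [trace_mul_comm, Matrix.mul_assoc, hU, Matrix.mul_one]
      _ = -trace (M * Dᵀ) := by
          rw [← trace_transpose, transpose_mul, transpose_transpose, trace_mul_comm]
  rw [Matrix.smul_mul, trace_smul, Matrix.sub_mul, trace_sub, h, smul_eq_mul]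
  ring

theorem trace_hadamard_mul_transpose {ι R : Type*} [Fintype ι] [CommSemiring R]
    (H A B : Matrix ι ι R) : trace (hadamard H A * Bᵀ) = trace (A * (hadamard H B)ᵀ) := by
  simp only [trace, diag_apply, mul_apply, hadamard_apply, transpose_apply]
  exact Finset.sum_congr rfl fun i _ => Finset.sum_congr rfl fun j _ => by ring

/-- the adjoint identity for the differential
`DF(X)[(ΔU, ΔV, ΔW)] = ΔU Σ Vᵀ + U Σ ΔVᵀ − ΔW`, with respect to the Frobenius inner
product `⟨A, B⟩ = trace (A Bᵀ)`.  Here `S` plays the role of `Σ`, `hadamard` is the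
Hadamard (entrywise) product, `UᵀΔU` and `VᵀΔV` are skew-symmetric, and
`H ⊙ ΔW = ΔW`. -/
theorem stmt_9 {n : ℕ} (U V S ΔU ΔV ΔW ΔZ H : Matrix (Fin n) (Fin n) ℝ)
    (hU : Uᵀ * U = 1) (hV : Vᵀ * V = 1)
    (hΔU : (Uᵀ * ΔU)ᵀ = -(Uᵀ * ΔU)) (hΔV : (Vᵀ * ΔV)ᵀ = -(Vᵀ * ΔV))
    (hΔW : Matrix.hadamard H ΔW = ΔW) :
    Matrix.trace (ΔZ * (ΔU * S * Vᵀ + U * S * ΔVᵀ - ΔW)ᵀ) =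
      Matrix.trace (((1 / 2 : ℝ) • (ΔZ * V * Sᵀ - U * S * Vᵀ * ΔZᵀ * U)) * ΔUᵀ) +
      Matrix.trace (((1 / 2 : ℝ) • (ΔZᵀ * U * S - V * Sᵀ * Uᵀ * ΔZ * V)) * ΔVᵀ) +
      Matrix.trace ((-(Matrix.hadamard H ΔZ)) * ΔWᵀ) := by
  have h₁ := trace_tangent_projection_mul_transpose (ΔZ * V * Sᵀ) hU hΔU
  have h₂ := trace_tangent_projection_mul_transpose (ΔZᵀ * U * S) hV hΔV
  have h₃ : trace (ΔZᵀ * U * S * ΔVᵀ) = trace (ΔZ * (U * S * ΔVᵀ)ᵀ) := by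
    rw [← trace_transpose, trace_mul_comm ΔZ]
    simp only [transpose_mul, transpose_transpose, Matrix.mul_assoc]
  simp only [transpose_mul, transpose_transpose, ← Matrix.mul_assoc] at h₁ h₂ h₃
  rw [h₁, h₂, h₃, Matrix.neg_mul, trace_neg, trace_hadamard_mul_transpose, hΔW]
  simp only [transpose_sub, transpose_add, transpose_mul, transpose_transpose, Matrix.mul_sub,
    Matrix.mul_add, trace_sub, trace_add, ← Matrix.mul_assoc]
  exact sub_eq_add_neg _ _
end

section
/- Let n ∈ ℕ and let Q, ΔQ, A, ΔZ, P, ΔP be real n×n matrices with QᵀQ = I and ΔQ Qᵀ skew-symmetric. Then ⟨ΔZ, 2 P ⊙ ΔP + [Q A Qᵀ, ΔQ Qᵀ]⟩ = ⟨2 P ⊙ ΔZ, ΔP⟩ + ⟨(1/2)([Q A Qᵀ, ΔZᵀ] + [Q Aᵀ Qᵀ, ΔZ]) Q, ΔQ⟩, where [X, Y] := XY − YX is the Lie bracket, ⊙ denotes the Hadamard (entrywise) product, and ⟨X, Y⟩ := trace(X Yᵀ) is the Frobenius inner product. -/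
open Matrix

section FrobeniusAdjoint

variable {m R : Type*} [Fintype m] [CommRing R]

theorem trace_mul_transpose_smul_hadamard (c : R) (Z P D : Matrix m m R) :
    trace (Z * (c • hadamard P D)ᵀ) = trace ((c • hadamard P Z) * Dᵀ) := by
  simp only [trace, diag_apply, mul_apply, transpose_apply, Matrix.smul_apply, hadamard_apply,
    smul_eq_mul]
  exact Finset.sum_congr rfl fun _ _ => Finset.sum_congr rfl fun _ _ => by ring

/-- The Frobenius adjoint of `S ↦ [X, S]` is `Z ↦ [Xᵀ, Z]`. -/
theorem trace_mul_transpose_commutator (X S Z : Matrix m m R) :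
    trace (Z * (X * S - S * X)ᵀ) = trace ((Xᵀ * Z - Z * Xᵀ) * Sᵀ) := by
  simp only [transpose_sub, transpose_mul, Matrix.mul_sub, Matrix.sub_mul, trace_sub]
  rw [← Matrix.mul_assoc, trace_mul_comm (Z * Sᵀ) Xᵀ]
  simp only [Matrix.mul_assoc]

/-- Against a skew-symmetric matrix, the Frobenius pairing changes sign under transposition. -/
theorem trace_transpose_mul_of_transpose_eq_neg {S : Matrix m m R} (hS : Sᵀ = -S)
    (M : Matrix m m R) : trace (Mᵀ * S) = -trace (M * S) := by
  rw [← trace_transpose, transpose_mul, transpose_transpose, hS, Matrix.neg_mul, trace_neg,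
    trace_mul_comm]

end FrobeniusAdjoint

/-- the adjoint identity for the differential
`DH(P,Q)[(ΔP, ΔQ)] = 2P⊙ΔP + [QAQᵀ, ΔQQᵀ]`, with respect to the Frobenius inner
product `⟨X, Y⟩ = trace (X Yᵀ)`, where `[X, Y] = XY − YX`, `⊙` is the Hadamard
product, `QᵀQ = I`, and `ΔQQᵀ` is skew-symmetric. -/
theorem stmt_10 {n : ℕ} (Q ΔQ A ΔZ P ΔP : Matrix (Fin n) (Fin n) ℝ)
    (hQ : Qᵀ * Q = 1) (hΔQ : (ΔQ * Qᵀ)ᵀ = -(ΔQ * Qᵀ)) :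
    Matrix.trace (ΔZ *
        ((2 : ℝ) • Matrix.hadamard P ΔP +
          ((Q * A * Qᵀ) * (ΔQ * Qᵀ) - (ΔQ * Qᵀ) * (Q * A * Qᵀ)))ᵀ) =
      Matrix.trace (((2 : ℝ) • Matrix.hadamard P ΔZ) * ΔPᵀ) +
      Matrix.trace ((((1 / 2 : ℝ) •
        (((Q * A * Qᵀ) * ΔZᵀ - ΔZᵀ * (Q * A * Qᵀ)) +
         ((Q * Aᵀ * Qᵀ) * ΔZ - ΔZ * (Q * Aᵀ * Qᵀ)))) * Q) * ΔQᵀ) := by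
  have hX : (Q * A * Qᵀ)ᵀ = Q * Aᵀ * Qᵀ := by
    simp only [transpose_mul, transpose_transpose, Matrix.mul_assoc]
  have hS : Q * ΔQᵀ = -(ΔQ * Qᵀ) := by
    rw [← hΔQ, transpose_mul, transpose_transpose]
  rw [transpose_add, Matrix.mul_add, trace_add, trace_mul_transpose_smul_hadamard,
    trace_mul_transpose_commutator, hX, hΔQ, Matrix.mul_assoc _ Q ΔQᵀ, hS]
  have hT : (Q * A * Qᵀ) * ΔZᵀ - ΔZᵀ * (Q * A * Qᵀ) =
      (-((Q * Aᵀ * Qᵀ) * ΔZ - ΔZ * (Q * Aᵀ * Qᵀ)))ᵀ := by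
    rw [← hX]
    simp only [transpose_sub, transpose_mul ΔZ, transpose_mul _ ΔZ,
      transpose_transpose, neg_sub]
  congr 1
  rw [hT, Matrix.smul_mul, trace_smul, Matrix.add_mul, trace_add, Matrix.mul_neg,
    Matrix.mul_neg, trace_neg, trace_neg, trace_transpose_mul_of_transpose_eq_neg hΔQ,
    Matrix.neg_mul, trace_neg, smul_eq_mul]
  ring
end

section
/- Let n ≥ 1, let d : Fin n → ℝ, and let Λ be a multiset of n complex numbers that is closed under complex conjugation. Then there exists a real n×n matrix A whose multiset of complex eigenvalues (the roots of its characteristic polynomial over ℂ, counted with multiplicity) equals Λ and whose diagonal entries are d_1,…,d_n, if and only if Σ_{λ ∈ Λ} λ = Σ_{i=1}^{n} d_i. -/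
open Polynomial in
/-- The Newton basis polynomials with nodes `e 0, e 1, …`. -/
noncomputable def newtonSequence {K : Type*} [Field K] (e : ℕ → K) : Polynomial.Sequence K where
  elems' k := ∏ i ∈ Finset.range k, (X - C (e i))
  degree_eq' k := by
    rw [degree_prod]
    simp

namespace newtonSequence

open Polynomial

variable {K : Type*} [Field K]

theorem X_mul_apply (e : ℕ → K) (k : ℕ) :
    X * newtonSequence e k = newtonSequence e (k + 1) + C (e k) * newtonSequence e k := by
  change X * ∏ i ∈ Finset.range k, (X - C (e i)) =
    ∏ i ∈ Finset.range (k + 1), (X - C (e i)) + C (e k) * ∏ i ∈ Finset.range k, (X - C (e i))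
  rw [Finset.prod_range_succ]
  ring

theorem linearIndependent_mk (e : ℕ → K) {p : K[X]} (hp : p ≠ 0) {n : ℕ}
    (hn : p.natDegree = n) :
    LinearIndependent K fun i : Fin n => AdjoinRoot.mk p (newtonSequence e i) := by
  rw [Fintype.linearIndependent_iff]
  intro g hg
  have hind := (newtonSequence e).linearIndependent.comp _ (Fin.val_injective (n := n))
  refine Fintype.linearIndependent_iff.mp hind g ?_
  have hmk : AdjoinRoot.mk p (∑ i : Fin n, g i • newtonSequence e i) = 0 := by
    rw [← hg, map_sum]
    simp only [AdjoinRoot.smul_mk]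
  refine eq_zero_of_dvd_of_degree_lt (AdjoinRoot.mk_eq_zero.mp hmk) ?_
  rw [degree_eq_natDegree hp, hn, ← mem_degreeLT]
  refine Submodule.sum_mem _ fun i _ => Submodule.smul_mem _ _ ?_
  rw [mem_degreeLT, Function.comp_apply, Sequence.degree_eq]
  exact_mod_cast i.2

/-- Any monic polynomial is the characteristic polynomial of a matrix with all but the last
diagonal entry prescribed. -/
theorem exists_matrix_charpoly_eq (e : ℕ → K) {p : K[X]} (hp : p.Monic) {n : ℕ}
    (hn : p.natDegree = n) :
    ∃ A : Matrix (Fin n) (Fin n) K, A.charpoly = p ∧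
      ∀ i : Fin n, (i : ℕ) + 1 < n → A i i = e i := by
  have : Module.Free K (AdjoinRoot p) := hp.free_adjoinRoot
  have : Module.Finite K (AdjoinRoot p) := hp.finite_adjoinRoot
  have hrank : Fintype.card (Fin n) = Module.finrank K (AdjoinRoot p) := by
    rw [(AdjoinRoot.powerBasis' hp).finrank, AdjoinRoot.powerBasis'_dim, hn, Fintype.card_fin]
  rcases Nat.eq_zero_or_pos n with rfl | hpos
  · refine ⟨0, ?_, fun i => i.elim0⟩
    rw [hp.natDegree_eq_zero.mp hn]
    simp
  have : Nonempty (Fin n) := ⟨⟨0, hpos⟩⟩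
  let b := basisOfLinearIndependentOfCardEqFinrank
    (linearIndependent_mk e hp.ne_zero hn) hrank
  have hb (i : Fin n) : b i = AdjoinRoot.mk p (newtonSequence e i) := by simp [b]
  refine ⟨Algebra.leftMulMatrix b (AdjoinRoot.root p), ?_, fun i hi => ?_⟩
  · have h := charpoly_leftMulMatrix (AdjoinRoot.powerBasis' hp)
    rw [AdjoinRoot.powerBasis'_gen] at h
    rw [Algebra.leftMulMatrix_apply, LinearMap.charpoly_toMatrix] at h ⊢
    rw [h, AdjoinRoot.minpoly_root hp.ne_zero, hp.leadingCoeff]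
    simp
  · have key : AdjoinRoot.root p * b i = b ⟨i + 1, hi⟩ + e i • b i := by
      rw [hb, hb, ← AdjoinRoot.mk_X, ← map_mul, X_mul_apply, map_add, AdjoinRoot.smul_mk,
        smul_eq_C_mul]
    rw [Algebra.leftMulMatrix_eq_repr_mul, key]
    simp [Fin.ext_iff]

end newtonSequence

open Polynomial in
/-- A multiset of complex numbers closed under conjugation is the root multiset of a real
monic polynomial. -/
theorem Multiset.exists_real_monic_of_map_conj_eq {Λ : Multiset ℂ}
    (h : Λ.map (starRingEnd ℂ) = Λ) :
    ∃ p : ℝ[X], p.Monic ∧ p.natDegree = Λ.card ∧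
      p.map Complex.ofRealHom = (Λ.map fun a => X - C a).prod := by
  set q : ℂ[X] := (Λ.map fun a => X - C a).prod with hq
  have hconj : q.map (starRingEnd ℂ) = q := by
    conv_rhs => rw [hq, ← h]
    simp [hq, Polynomial.map_multiset_prod, Multiset.map_map]
  have hlift : q ∈ lifts Complex.ofRealHom := by
    rw [lifts_iff_coeff_lifts]
    intro k
    have hk : (starRingEnd ℂ) (q.coeff k) = q.coeff k := by
      rw [← coeff_map, hconj]
    exact ⟨_, Complex.conj_eq_iff_re.mp hk⟩
  have hmonic : q.Monic := monic_multiset_prod_of_monic _ _ fun a _ => monic_X_sub_C a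
  obtain ⟨p, hpq, hdeg, hp⟩ := lifts_and_natDegree_eq_and_monic hlift hmonic
  exact ⟨p, hp, hdeg.trans (natDegree_multiset_prod_X_sub_C_eq_card Λ), hpq⟩


/-- Mirsky condition: given `n ≥ 1`, a multiset `Λ` of `n` complex
numbers closed under conjugation, and prescribed diagonal entries `d`, there exists a
real `n×n` matrix whose complex eigenvalues (roots of its characteristic polynomial
over `ℂ`, with multiplicity) are `Λ` and whose diagonal entries are `d`, if and only
if `Σ_{λ ∈ Λ} λ = Σᵢ dᵢ`. -/
theorem stmt_12 (n : ℕ) (hn : 1 ≤ n) (d : Fin n → ℝ) (Λ : Multiset ℂ)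
    (hcard : Multiset.card Λ = n)
    (hconj : Λ.map (fun z => (starRingEnd ℂ) z) = Λ) :
    (∃ A : Matrix (Fin n) (Fin n) ℝ,
        (A.map (fun x => (x : ℂ))).charpoly.roots = Λ ∧ ∀ i, A i i = d i) ↔
      Λ.sum = ∑ i, (d i : ℂ) := by
  have trace_eq (A : Matrix (Fin n) (Fin n) ℝ)
      (hA : (A.map (fun x => (x : ℂ))).charpoly.roots = Λ) : Λ.sum = ∑ i, (A i i : ℂ) := by
    rw [← hA, ← Matrix.trace_eq_sum_roots_charpoly]
    rfl
  constructor
  · rintro ⟨A, hA, hd⟩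
    simpa only [hd] using trace_eq A hA
  intro hsum
  obtain ⟨m, rfl⟩ : ∃ m, n = m + 1 := ⟨n - 1, by omega⟩
  obtain ⟨p, hp, hdeg, hpΛ⟩ := Multiset.exists_real_monic_of_map_conj_eq hconj
  obtain ⟨A, hAp, hAd⟩ := newtonSequence.exists_matrix_charpoly_eq
    (fun k => d (Fin.ofNat (m + 1) k)) hp (hdeg.trans hcard)
  have hroots : (A.map (fun x => (x : ℂ))).charpoly.roots = Λ := by
    change (A.map Complex.ofRealHom).charpoly.roots = Λ
    rw [Matrix.charpoly_map, hAp, hpΛ, Polynomial.roots_multiset_prod_X_sub_C]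
  have hinit (i : Fin m) : A i.castSucc i.castSucc = d i.castSucc := by
    rw [hAd _ (by simp)]
    simp
  refine ⟨A, hroots, Fin.lastCases ?_ hinit⟩
  have h := (trace_eq A hroots).symm.trans hsum
  simp only [Fin.sum_univ_castSucc, hinit] at h
  exact_mod_cast add_left_cancel h
end
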